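/- The special set s can enter the assignments only at stage 0: assume rk(M i) < rk(s) for every i : ι. Then for every n ∈ ℕ and every x : ι, s ∈ Mₙ x if and only if s ∈ M₀ x. -/

import Mathlib

-- The recursive enlargement construction from the convexity proof for MLS:
-- `mlsStage M N s t n = (Vₙ, Mₙ)`, where
-- `V₀ = {u | t ∈ N u}`, `Vₙ₊₁ = {u | ∃ v ∈ Vₙ, M v ∈ M u}`,
-- `M₀ u = M u ∪ {s}` if `u ∈ V₀` and `M u` otherwise, and
-- `Mₙ₊₁ u = Mₙ u ∪ {Mₙ v | v ∈ Vₙ ∧ M v ∈ M u}` if `u ∈ Vₙ₊₁` and `Mₙ u` otherwise.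
open Classical in
noncomputable def mlsStage {ι : Type} [Fintype ι] (M N : ι → ZFSet) (s t : ZFSet) :
    ℕ → Set ι × (ι → ZFSet)
  | 0 => ({u | t ∈ N u}, fun u => if t ∈ N u then M u ∪ {s} else M u)
  | n + 1 =>
      let P := mlsStage M N s t n
      ({u | ∃ v ∈ P.1, M v ∈ M u},
        fun u =>
          if ∃ v ∈ P.1, M v ∈ M u then
            P.2 u ∪ ZFSet.range (fun v : {v : ι // v ∈ P.1 ∧ M v ∈ M u} => P.2 v.1)
          else P.2 u)

/-- `Vₙ`, the set of variables modified at stage `n`. -/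
noncomputable def mlsV {ι : Type} [Fintype ι] (M N : ι → ZFSet) (s t : ZFSet) (n : ℕ) :
    Set ι :=
  (mlsStage M N s t n).1

/-- `Mₙ`, the enlarged assignment at stage `n`. -/
noncomputable def mlsM {ι : Type} [Fintype ι] (M N : ι → ZFSet) (s t : ZFSet) (n : ℕ) :
    ι → ZFSet :=
  (mlsStage M N s t n).2

theorem mlsM_succ_of_mem {ι : Type} [Fintype ι] {M N : ι → ZFSet} {s t : ZFSet} {n : ℕ} {u : ι}
    (hu : u ∈ mlsV M N s t (n + 1)) :
    mlsM M N s t (n + 1) u = mlsM M N s t n u ∪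
      ZFSet.range (fun v : {v : ι // v ∈ mlsV M N s t n ∧ M v ∈ M u} => mlsM M N s t n v.1) :=
  if_pos hu

theorem mlsM_succ_of_notMem {ι : Type} [Fintype ι] {M N : ι → ZFSet} {s t : ZFSet} {n : ℕ}
    {u : ι} (hu : u ∉ mlsV M N s t (n + 1)) :
    mlsM M N s t (n + 1) u = mlsM M N s t n u :=
  if_neg hu

/-- A variable modified at stage `n` has an enlarged value of rank greater than that of `s`. -/
theorem rank_lt_rank_mlsM {ι : Type} [Fintype ι] {M N : ι → ZFSet} {s t : ZFSet} {n : ℕ} {u : ι}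
    (hu : u ∈ mlsV M N s t n) : s.rank < (mlsM M N s t n u).rank := by
  induction n generalizing u with
  | zero =>
    have h : mlsM M N s t 0 u = M u ∪ {s} := if_pos hu
    exact ZFSet.rank_lt_of_mem (by simp [h])
  | succ n ih =>
    obtain ⟨v, hv, hvu⟩ := id hu
    refine (ih hv).trans (ZFSet.rank_lt_of_mem ?_)
    rw [mlsM_succ_of_mem hu, ZFSet.mem_union, ZFSet.mem_range]
    exact Or.inr ⟨⟨v, hv, hvu⟩, rfl⟩

/-- The special set `s` can enter the assignments only at stage `0`:
`s ∈ Mₙ x ↔ s ∈ M₀ x`. -/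
theorem special_mem_mlsM_iff {ι : Type} [Fintype ι] (M N : ι → ZFSet) (s t : ZFSet)
    (hrk : ∀ i : ι, (M i).rank < s.rank) :
    ∀ (n : ℕ) (x : ι), s ∈ mlsM M N s t n x ↔ s ∈ mlsM M N s t 0 x := by
  intro n x
  induction n with
  | zero => rfl
  | succ n ih =>
    rw [← ih]
    by_cases hx : x ∈ mlsV M N s t (n + 1)
    · rw [mlsM_succ_of_mem hx, ZFSet.mem_union, ZFSet.mem_range, or_iff_left]
      rintro ⟨v, h⟩
      exact (rank_lt_rank_mlsM v.2.1).ne (congrArg ZFSet.rank h).symm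
    · rw [mlsM_succ_of_notMem hx]
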